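/- arXiv:1707.03600 — 2 statements merged into one kernel-verified Lean document; each statement's English description precedes it below -/
import Mathlib

section
/- For every real ε > 0 there exists an integer k₀ such that for every integer k ≥ k₀, every tournament T with minimum out-degree δ⁺(T) ≥ (2 + ε)·k admits a bisection (A, B) of its vertex set such that for every vertex v of T, both d_A⁺(v) ≥ k and d_B⁺(v) ≥ k. (In other words, every tournament with δ⁺(T) ≥ (2 + o(1))k admits a bisection in which every vertex keeps at least k out-neighbors in each part.) -/
open Finset

/-- Out-degree of `v` in the digraph `D`. -/
def outDeg {V : Type*} [Fintype V] (D : V → V → Prop) [DecidableRel D] (v : V) : ℕ :=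
  (Finset.univ.filter (fun w => D v w)).card

/-- Number of out-neighbors of `v` lying in the set `S`. -/
def outDegIn {V : Type*} [Fintype V] (D : V → V → Prop) [DecidableRel D]
    (S : Finset V) (v : V) : ℕ :=
  (S.filter (fun w => D v w)).card

/-- A tournament: an irreflexive digraph in which every pair of distinct vertices is
joined by exactly one arc. -/
def IsTournament {V : Type*} (D : V → V → Prop) : Prop :=
  (∀ v, ¬ D v v) ∧ ∀ u v, u ≠ v → (D u v ↔ ¬ D v u)

/-- The moment generating function of a signed sum is sub-Gaussian. -/
theorem sum_exp_signed_sum_le {ι : Type*} [Fintype ι] [DecidableEq ι] (c : ι → ℝ) :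
    ∑ s : ι → ℤˣ, Real.exp (∑ i, c i * ((s i : ℤ) : ℝ)) ≤
      2 ^ Fintype.card ι * Real.exp ((∑ i, c i ^ 2) / 2) := by
  have hfactor : ∑ s : ι → ℤˣ, Real.exp (∑ i, c i * ((s i : ℤ) : ℝ)) =
      ∏ i, ∑ u : ℤˣ, Real.exp (c i * ((u : ℤ) : ℝ)) := by
    rw [Finset.prod_univ_sum, Fintype.piFinset_univ]
    exact Finset.sum_congr rfl fun s _ => Real.exp_sum _ _
  have hbound (i : ι) : ∑ u : ℤˣ, Real.exp (c i * ((u : ℤ) : ℝ)) ≤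
      2 * Real.exp (c i ^ 2 / 2) := by
    have h := Real.cosh_le_exp_half_sq (c i)
    rw [Real.cosh_eq] at h
    rw [UnitsInt.univ, Finset.sum_pair (by decide)]
    push_cast [Units.val_neg, Units.val_one]
    rw [mul_one, mul_neg_one]
    linarith
  rw [hfactor]
  calc ∏ i, ∑ u : ℤˣ, Real.exp (c i * ((u : ℤ) : ℝ))
      ≤ ∏ i, 2 * Real.exp (c i ^ 2 / 2) :=
        Finset.prod_le_prod (fun i _ => Finset.sum_nonneg fun _ _ => (Real.exp_pos _).le)
          fun i _ => hbound i
    _ = 2 ^ Fintype.card ι * Real.exp ((∑ i, c i ^ 2) / 2) := by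
        rw [Finset.prod_mul_distrib, ← Real.exp_sum, Finset.sum_div]
        simp

theorem sq_sum_units_le_card (G : Finset ℤˣ) : (∑ u ∈ G, (u : ℤ)) ^ 2 ≤ #G := by
  revert G
  decide

/-- If every block contains at most one vertex of each sign, the squared block sums of a set of
vertices add up to at most its size. -/
theorem sum_sq_block_sum_le {V ι : Type*} [Fintype ι] [DecidableEq ι] (b : V → ι) (p : V → ℤˣ)
    (hbp : Function.Injective fun v => (b v, p v)) (N : Finset V) :
    ∑ i, (∑ v ∈ N with b v = i, ((p v : ℤ) : ℝ)) ^ 2 ≤ #N := by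
  have hblock (i : ι) :
      (∑ v ∈ N with b v = i, ((p v : ℤ) : ℝ)) ^ 2 ≤ (#{v ∈ N | b v = i} : ℝ) := by
    have hinj : Set.InjOn p ({v ∈ N | b v = i} : Finset V) := by
      intro v hv w hw hvw
      rw [Finset.mem_coe, Finset.mem_filter] at hv hw
      exact hbp (Prod.ext (hv.2.trans hw.2.symm) hvw)
    have h := sq_sum_units_le_card ({v ∈ N | b v = i}.image p)
    rw [Finset.sum_image hinj, Finset.card_image_of_injOn hinj] at h
    exact_mod_cast h
  calc _ ≤ ∑ i, (#{v ∈ N | b v = i} : ℝ) := Finset.sum_le_sum fun i _ => hblock i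
    _ = #N := by
      rw [Finset.card_eq_sum_card_fiberwise (f := b) (t := Finset.univ) (by simp)]
      push_cast
      rfl

theorem sum_exp_block_coloring_le {V ι : Type*} [Fintype ι] [DecidableEq ι] (b : V → ι)
    (p : V → ℤˣ) (hbp : Function.Injective fun v => (b v, p v)) (N : Finset V) (t : ℝ) :
    ∑ s : ι → ℤˣ, Real.exp (t * ∑ w ∈ N, (((s (b w) * p w : ℤˣ) : ℤ) : ℝ)) ≤
      2 ^ Fintype.card ι * Real.exp (t ^ 2 * #N / 2) := by
  have hrewrite (s : ι → ℤˣ) : t * ∑ w ∈ N, (((s (b w) * p w : ℤˣ) : ℤ) : ℝ) =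
      ∑ i, (t * ∑ w ∈ N with b w = i, ((p w : ℤ) : ℝ)) * ((s i : ℤ) : ℝ) := by
    rw [← Finset.sum_fiberwise N b, Finset.mul_sum]
    refine Finset.sum_congr rfl fun i _ => ?_
    rw [mul_assoc, Finset.sum_mul]
    congr 1
    refine Finset.sum_congr rfl fun w hw => ?_
    rw [(Finset.mem_filter.1 hw).2]
    push_cast
    ring
  simp_rw [hrewrite]
  refine (sum_exp_signed_sum_le _).trans ?_
  simp_rw [mul_pow]
  rw [← Finset.mul_sum]
  have := sum_sq_block_sum_le b p hbp N
  gcongr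

/-- If the sum of the failure probabilities is below one, some choice of block signs keeps all
signed sums over the sets `N v` small. -/
theorem exists_signs_abs_sum_le {V ι : Type*} [Fintype V] [Fintype ι] [DecidableEq ι] (b : V → ι)
    (p : V → ℤˣ) (hbp : Function.Injective fun v => (b v, p v)) (N : V → Finset V) (η : ℝ)
    (hη : 0 < η) (hsum : ∑ v, Real.exp (-(η ^ 2 / 2) * #(N v)) < 1 / 2) :
    ∃ s : ι → ℤˣ, ∀ v, |∑ w ∈ N v, (((s (b w) * p w : ℤˣ) : ℤ) : ℝ)| ≤ η * #(N v) := by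
  by_contra! hbad
  set X : (ι → ℤˣ) → V → ℝ := fun s v => ∑ w ∈ N v, (((s (b w) * p w : ℤˣ) : ℤ) : ℝ)
  set F : (ι → ℤˣ) → V → ℝ := fun s v =>
    Real.exp (-(η ^ 2 * #(N v))) * (Real.exp (η * X s v) + Real.exp (-η * X s v)) with hF
  have hF0 (s v) : 0 ≤ F s v := by positivity
  have hlower (s : ι → ℤˣ) : 1 ≤ ∑ v, F s v := by
    obtain ⟨v, hv⟩ := hbad s
    change η * #(N v) < |X s v| at hv
    refine le_trans ?_ (Finset.single_le_sum (fun v _ => hF0 s v) (Finset.mem_univ v))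
    simp only [hF, mul_add, ← Real.exp_add]
    rcases lt_abs.1 hv with h | h
    · have : 1 ≤ Real.exp (-(η ^ 2 * #(N v)) + η * X s v) := Real.one_le_exp (by nlinarith)
      linarith [Real.exp_pos (-(η ^ 2 * #(N v)) + -η * X s v)]
    · have : 1 ≤ Real.exp (-(η ^ 2 * #(N v)) + -η * X s v) := Real.one_le_exp (by nlinarith)
      linarith [Real.exp_pos (-(η ^ 2 * #(N v)) + η * X s v)]
  have hupper (v : V) : ∑ s, F s v ≤
      2 ^ Fintype.card ι * (2 * Real.exp (-(η ^ 2 / 2) * #(N v))) := by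
    have h₁ := sum_exp_block_coloring_le b p hbp (N v) η
    have h₂ := sum_exp_block_coloring_le b p hbp (N v) (-η)
    rw [neg_sq] at h₂
    have hexp : Real.exp (-(η ^ 2 / 2) * #(N v)) =
        Real.exp (-(η ^ 2 * #(N v))) * Real.exp (η ^ 2 * #(N v) / 2) := by
      rw [← Real.exp_add]
      ring_nf
    simp only [hF, ← Finset.mul_sum, Finset.sum_add_distrib]
    rw [hexp]
    have := mul_le_mul_of_nonneg_left (add_le_add h₁ h₂) (Real.exp_pos (-(η ^ 2 * #(N v)))).le
    linarith
  have htotal : (2 : ℝ) ^ Fintype.card ι ≤ ∑ s, ∑ v, F s v := by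
    calc (2 : ℝ) ^ Fintype.card ι = ∑ _s : ι → ℤˣ, (1 : ℝ) := by simp
      _ ≤ _ := Finset.sum_le_sum fun s _ => hlower s
  rw [Finset.sum_comm] at htotal
  have h := htotal.trans (Finset.sum_le_sum fun v _ => hupper v)
  rw [← Finset.mul_sum, ← Finset.mul_sum] at h
  have hpos : (0 : ℝ) < 2 ^ Fintype.card ι := by positivity
  nlinarith

theorem abs_sum_range_alternating_le_one (g : ℕ → ℤˣ) (n : ℕ) :
    |∑ j ∈ Finset.range n, ((g (j / 2) * (-1) ^ j : ℤˣ) : ℤ)| ≤ 1 := by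
  have heven (m : ℕ) :
      ∑ j ∈ Finset.range (2 * m), ((g (j / 2) * (-1) ^ j : ℤˣ) : ℤ) = 0 := by
    induction m with
    | zero => simp
    | succ m ih =>
      rw [show 2 * (m + 1) = 2 * m + 1 + 1 by ring, Finset.sum_range_succ, Finset.sum_range_succ,
        ih, show (2 * m + 1) / 2 = m by omega, show 2 * m / 2 = m by omega]
      simp [pow_succ]
  obtain ⟨m, rfl | rfl⟩ := Nat.even_or_odd' n
  · rw [heven]
    norm_num
  · rw [Finset.sum_range_succ, heven, zero_add]
    exact (Int.isUnit_iff_abs_eq.1 (Units.isUnit _)).le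

/-- A finite set can be cut into blocks of size two (and at most one of size one), each containing
at most one element of each sign, so that every choice of block signs is nearly balanced. -/
theorem exists_balanced_blocks (V : Type*) [Fintype V] :
    ∃ (b : V → Fin (Fintype.card V)) (p : V → ℤˣ), (Function.Injective fun v => (b v, p v)) ∧
      ∀ s : Fin (Fintype.card V) → ℤˣ, |∑ v, ((s (b v) * p v : ℤˣ) : ℤ)| ≤ 1 := by
  set n := Fintype.card V
  let e : V ≃ Fin n := Fintype.equivFin V
  refine ⟨fun v => ⟨(e v : ℕ) / 2, (Nat.div_le_self _ _).trans_lt (e v).2⟩,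
    fun v => (-1) ^ (e v : ℕ), ?_, fun s => ?_⟩
  · intro v w h
    simp only [Prod.mk.injEq, Fin.mk.injEq] at h
    obtain ⟨hdiv, hsign⟩ := h
    apply e.injective
    apply Fin.ext
    have hne : (-1 : ℤˣ) ≠ 1 := by decide
    rcases Nat.even_or_odd (e v : ℕ) with hv | hv <;> rcases Nat.even_or_odd (e w : ℕ) with hw | hw
    · grind
    · rw [hv.neg_one_pow, hw.neg_one_pow] at hsign
      exact absurd hsign.symm hne
    · rw [hv.neg_one_pow, hw.neg_one_pow] at hsign
      exact absurd hsign hne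
    · grind
  · let g : ℕ → ℤˣ := fun i => if h : i < n then s ⟨i, h⟩ else 1
    have h := abs_sum_range_alternating_le_one g n
    rw [Finset.sum_range, ← e.sum_comp] at h
    have hg (v : V) : g ((e v : ℕ) / 2) =
        s ⟨(e v : ℕ) / 2, (Nat.div_le_self _ _).trans_lt (e v).2⟩ :=
      dif_pos _
    simpa only [hg] using h

/-- In a tournament, a set of vertices of out-degree at most `d` has at most `2 * d + 1`
elements. -/
theorem IsTournament.card_le_of_outDeg_le {V : Type*} [Fintype V] [DecidableEq V]
    {T : V → V → Prop} [DecidableRel T] (hT : IsTournament T) (S : Finset V) (d : ℕ)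
    (hS : ∀ v ∈ S, outDeg T v ≤ d) : #S ≤ 2 * d + 1 := by
  have hpair (u v : V) :
      1 ≤ (if T u v then 1 else 0) + (if T v u then 1 else 0) + (if u = v then 1 else 0) := by
    by_cases huv : u = v
    · simp [huv]
    · have := hT.2 u v huv
      by_cases h : T v u <;> simp_all
  have hdeg (u : V) (hu : u ∈ S) : ∑ v ∈ S, (if T u v then 1 else 0) ≤ d := by
    rw [← Finset.card_filter]
    exact (Finset.card_le_card (Finset.filter_subset_filter _ (Finset.subset_univ S))).trans
      (hS u hu)
  have hsum : ∑ u ∈ S, ∑ v ∈ S, (if T u v then 1 else 0) ≤ #S * d := by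
    simpa using Finset.sum_le_sum hdeg
  have htotal : #S * #S ≤ ∑ u ∈ S, ∑ v ∈ S,
      ((if T u v then 1 else 0) + (if T v u then 1 else 0) + (if u = v then 1 else 0)) := by
    simpa using Finset.sum_le_sum fun u (_ : u ∈ S) =>
      Finset.sum_le_sum fun v (_ : v ∈ S) => hpair u v
  simp only [Finset.sum_add_distrib] at htotal
  rw [Finset.sum_comm (f := fun u v => if T v u then 1 else 0)] at htotal
  have hdiag : ∑ u ∈ S, ∑ v ∈ S, (if u = v then 1 else 0) = #S := by simp
  rw [hdiag] at htotal
  by_contra! hlt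
  nlinarith

/-- For tournaments of large minimum out-degree, the sum of `exp (-c * d⁺(v))` is small. -/
theorem exists_sum_exp_outDeg_lt {c δ : ℝ} (hc : 0 < c) (hδ : 0 < δ) :
    ∃ d₀ : ℕ, ∀ (V : Type) [Fintype V] [DecidableEq V] (T : V → V → Prop) [DecidableRel T],
      IsTournament T → (∀ v, d₀ ≤ outDeg T v) →
        ∑ v, Real.exp (-c * (outDeg T v : ℝ)) < δ := by
  have hsummable : Summable fun d : ℕ => (2 * d + 1 : ℝ) * Real.exp (-c * d) := by
    have h₁ := (Real.summable_pow_mul_exp_neg_nat_mul 1 hc).mul_left 2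
    have h₀ := Real.summable_pow_mul_exp_neg_nat_mul 0 hc
    refine (h₁.add h₀).congr fun d => ?_
    ring
  obtain ⟨s, hs⟩ := summable_iff_vanishing_norm.1 hsummable δ hδ
  refine ⟨s.sup id + 1, fun V _ _ T _ hT hd => ?_⟩
  have hdisj : Disjoint (Finset.univ.image (outDeg T)) s := by
    rw [Finset.disjoint_left]
    intro d hdT hds
    obtain ⟨v, -, rfl⟩ := Finset.mem_image.1 hdT
    have h₁ : outDeg T v ≤ s.sup id := Finset.le_sup (f := id) hds
    have h₂ := hd v
    omega
  refine lt_of_le_of_lt ?_ ((le_abs_self _).trans_lt (hs _ hdisj))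
  rw [Finset.sum_comp (fun d : ℕ => Real.exp (-c * (d : ℝ))) (outDeg T)]
  refine Finset.sum_le_sum fun d _ => ?_
  rw [nsmul_eq_mul]
  gcongr
  exact_mod_cast hT.card_le_of_outDeg_le {v | outDeg T v = d} d
    fun v hv => (Finset.mem_filter.1 hv).2.le

theorem sum_units_eq_card_sub_card {V : Type*} (N : Finset V) (c : V → ℤˣ) :
    ∑ v ∈ N, (c v : ℤ) = (#{v ∈ N | c v = 1} : ℤ) - #{v ∈ N | ¬ c v = 1} := by
  rw [Finset.card_filter, Finset.card_filter]
  push_cast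
  rw [← Finset.sum_sub_distrib]
  refine Finset.sum_congr rfl fun v _ => ?_
  rcases Int.units_eq_one_or (c v) with h | h <;> simp [h]

/-- Every tournament with minimum out-degree at least `(2 + o(1))k` admits a bisection
`(A, Aᶜ)` in which every vertex has at least `k` out-neighbors in each part. -/
theorem tournament_bisection_two_k (ε : ℝ) (hε0 : 0 < ε) :
    ∃ k₀ : ℕ, ∀ k : ℕ, k₀ ≤ k →
      ∀ (V : Type) [Fintype V] [DecidableEq V] (T : V → V → Prop) [DecidableRel T],
        IsTournament T →
        (∀ v, (2 + ε) * (k : ℝ) ≤ (outDeg T v : ℝ)) →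
        ∃ A : Finset V,
          |(A.card : ℤ) - ((Aᶜ : Finset V).card : ℤ)| ≤ 1 ∧
          ∀ v, k ≤ outDegIn T A v ∧ k ≤ outDegIn T Aᶜ v := by
  have h2ε : 0 < 2 + ε := by positivity
  set η := ε / (2 + ε) with hη
  have hη0 : 0 < η := by positivity
  obtain ⟨d₀, hd₀⟩ :=
    exists_sum_exp_outDeg_lt (c := η ^ 2 / 2) (δ := 1 / 2) (by positivity) (by norm_num)
  refine ⟨d₀, fun k hk V _ _ T _ hT hdeg => ?_⟩
  have hmin (v : V) : d₀ ≤ outDeg T v := by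
    have h₁ := hdeg v
    have h₂ : (k : ℝ) ≤ outDeg T v := by nlinarith [(Nat.cast_nonneg k : (0 : ℝ) ≤ k)]
    exact hk.trans (by exact_mod_cast h₂)
  obtain ⟨b, p, hbp, hbal⟩ := exists_balanced_blocks V
  obtain ⟨s, hs⟩ := exists_signs_abs_sum_le b p hbp (fun v => ({w | T v w} : Finset V)) η hη0
    (hd₀ V T hT hmin)
  refine ⟨({v | s (b v) * p v = 1} : Finset V), ?_, fun v => ?_⟩
  · have h := hbal s
    rw [sum_units_eq_card_sub_card] at h
    rwa [Finset.compl_filter]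
  · have h := hs v
    have hsum := sum_units_eq_card_sub_card ({w | T v w} : Finset V) fun w => s (b w) * p w
    have hcard := Finset.card_filter_add_card_filter_not (s := ({w | T v w} : Finset V))
      fun w => s (b w) * p w = 1
    have hd := hdeg v
    rw [Finset.compl_filter, outDegIn, outDegIn, Finset.filter_filter, Finset.filter_filter]
    simp only [outDeg, Finset.filter_filter, and_comm (a := T v _)] at h hsum hcard hd
    have hsumR := congrArg (Int.cast : ℤ → ℝ) hsum
    have hcardR := congrArg (Nat.cast : ℕ → ℝ) hcard
    push_cast at hsumR hcardR h
    rw [hsumR] at h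
    have hηd : 2 * (k : ℝ) ≤ (1 - η) * (#{w | T v w} : ℝ) := by
      have : 1 - η = 2 / (2 + ε) := by rw [hη]; field_simp; ring
      rw [this, div_mul_eq_mul_div, le_div_iff₀ h2ε]
      linarith
    obtain ⟨h₁, h₂⟩ := abs_le.1 h
    constructor
    · rify
      linarith
    · rify
      linarith
end

section
/- Let t, a, b, d be integers with t ≥ 1, 0 ≤ a < t, 2a + b = d, and d > 2t. Then ∑_{i=0}^{t−1−a} C(b−1, i)·(1/2)^{b−1} ≤ ∑_{i=0}^{t−1} C(d−1, i)·(1/2)^{d−1}. -/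
open Finset

theorem sum_range_choose_add_two (n k : ℕ) :
    ∑ i ∈ range (k + 2), (n + 2).choose i + n.choose k =
      4 * ∑ i ∈ range (k + 1), n.choose i + n.choose (k + 1) := by
  induction k with
  | zero => simp [sum_range_succ]; ring
  | succ k ih =>
    rw [sum_range_succ, sum_range_succ n.choose (k + 1)]
    have h : (n + 2).choose (k + 2) =
        n.choose k + 2 * n.choose (k + 1) + n.choose (k + 2) := by
      simp only [Nat.choose_succ_succ']
      ring
    linarith

theorem four_mul_sum_range_choose_le {n s : ℕ} (hs : 1 ≤ s) (hn : 2 * s ≤ n) :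
    4 * ∑ i ∈ range s, n.choose i ≤ ∑ i ∈ range (s + 1), (n + 2).choose i := by
  obtain ⟨k, rfl⟩ := Nat.exists_eq_add_of_le' hs
  have h := sum_range_choose_add_two n k
  have hle : n.choose k ≤ n.choose (k + 1) :=
    Nat.choose_le_succ_of_lt_half_left (by omega)
  show _ ≤ ∑ i ∈ range (k + 2), (n + 2).choose i
  omega

theorem four_pow_mul_sum_range_choose_le {n s : ℕ} (hs : 1 ≤ s) (hn : 2 * s ≤ n) (a : ℕ) :
    4 ^ a * ∑ i ∈ range s, n.choose i ≤ ∑ i ∈ range (s + a), (n + 2 * a).choose i := by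
  induction a with
  | zero => simp
  | succ a ih =>
    calc 4 ^ (a + 1) * ∑ i ∈ range s, n.choose i
        = 4 * (4 ^ a * ∑ i ∈ range s, n.choose i) := by ring
      _ ≤ 4 * ∑ i ∈ range (s + a), (n + 2 * a).choose i := by gcongr
      _ ≤ _ := four_mul_sum_range_choose_le (by omega) (by omega)

/-- For integers `t ≥ 1`, `0 ≤ a < t`, `2a + b = d`, `d > 2t`:
`∑_{i=0}^{t-1-a} C(b-1, i) (1/2)^{b-1} ≤ ∑_{i=0}^{t-1} C(d-1, i) (1/2)^{d-1}`. -/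
theorem binomial_tail_le (t a b d : ℕ) (ht : 1 ≤ t) (hat : a < t)
    (habd : 2 * a + b = d) (hd : 2 * t < d) :
    (∑ i ∈ Finset.range (t - a), ((b - 1).choose i : ℚ) * (1 / 2) ^ (b - 1)) ≤
    (∑ i ∈ Finset.range t, ((d - 1).choose i : ℚ) * (1 / 2) ^ (d - 1)) := by
  have h := four_pow_mul_sum_range_choose_le (n := b - 1) (s := t - a)
    (by omega) (by omega) a
  rw [Nat.sub_add_cancel hat.le, show b - 1 + 2 * a = d - 1 by omega] at h
  have hq : (4 : ℚ) ^ a * ∑ i ∈ range (t - a), ((b - 1).choose i : ℚ) ≤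
      ∑ i ∈ range t, ((d - 1).choose i : ℚ) := by exact_mod_cast h
  have hpow : ((1 : ℚ) / 2) ^ (b - 1) = 4 ^ a * (1 / 2) ^ (d - 1) := by
    rw [show d - 1 = 2 * a + (b - 1) by omega, pow_add, pow_mul, ← mul_assoc, ← mul_pow]
    norm_num
  rw [← sum_mul, ← sum_mul, hpow, ← mul_assoc, mul_comm _ ((4 : ℚ) ^ a)]
  gcongr
end
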